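/- (Whitney Extension Theorem, finite order.) Let U ⊆ ℝⁿ be open, X ⊆ U relatively closed and nonempty, and m ∈ ℕ. Then for every Whitney function F = (F_β)_{|β| ≤ m} of class m on X there exists f ∈ C^m(U,ℝ) such that ∂^β f(x) = F_β(x) for every x ∈ X and every multi-index β with |β| ≤ m. -/

import Mathlib

noncomputable section

/-- The Taylor remainder `(R^m_x F)_β (y)` of an `m`-jet
`F = (F_α)_{α}` on `ℝⁿ`:  `F_β y - ∑_{|α| ≤ m - |β|} F_{α+β} x · (y-x)^α / α!`. -/
def taylorRem {n : ℕ} (m : ℕ) (F : (Fin n → ℕ) → EuclideanSpace ℝ (Fin n) → ℝ)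
    (β : Fin n → ℕ) (x y : EuclideanSpace ℝ (Fin n)) : ℝ :=
  F β y - ∑ α ∈ (Finset.Iic (fun _ => m - ∑ i, β i : Fin n → ℕ)).filter
      (fun α => ∑ i, α i ≤ m - ∑ i, β i),
    (F (α + β) x * ∏ i, (y i - x i) ^ α i) / ∏ i, ((α i).factorial : ℝ)

/-- `F` is a Whitney function of class `m` on `X`: the components `F_β`, `|β| ≤ m`, are continuous
on `X` and for every compact `K ⊆ X` one has
`(R^m_x F)_β (y) = o(|x - y|^(m - |β|))` uniformly on `K × K`. -/
def IsWhitney {n : ℕ} (m : ℕ) (X : Set (EuclideanSpace ℝ (Fin n)))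
    (F : (Fin n → ℕ) → EuclideanSpace ℝ (Fin n) → ℝ) : Prop :=
  (∀ β : Fin n → ℕ, (∑ i, β i) ≤ m → ContinuousOn (F β) X) ∧
  ∀ K : Set (EuclideanSpace ℝ (Fin n)), IsCompact K → K ⊆ X →
    ∀ β : Fin n → ℕ, (∑ i, β i) ≤ m →
    ∀ ε > (0:ℝ), ∃ δ > (0:ℝ), ∀ x ∈ K, ∀ y ∈ K, 0 < dist x y → dist x y ≤ δ →
      |taylorRem m F β x y| ≤ ε * dist x y ^ (m - ∑ i, β i)

open Set Filter Topology Metric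
open scoped ContDiff

section TaylorPolynomials

variable {n : ℕ}

local notation "ℝ^n" => EuclideanSpace ℝ (Fin n)

/-- The monomial `(x - a)^α / α!`. -/
def taylorMonomial (α : Fin n → ℕ) (a x : ℝ^n) : ℝ :=
  (∏ i, (x i - a i) ^ α i) / ∏ i, ((α i).factorial : ℝ)

/-- The index set `{α : |α| ≤ d}`, in the form used by `taylorRem`. -/
def multiIndices (n d : ℕ) : Finset (Fin n → ℕ) :=
  (Finset.Iic (fun _ => d)).filter (fun α => ∑ i, α i ≤ d)

lemma mem_multiIndices {d : ℕ} {α : Fin n → ℕ} : α ∈ multiIndices n d ↔ ∑ i, α i ≤ d := by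
  simp only [multiIndices, Finset.mem_filter, Finset.mem_Iic, and_iff_right_iff_imp]
  intro h i
  exact (Finset.single_le_sum (f := α) (fun _ _ => Nat.zero_le _) (Finset.mem_univ i)).trans h

/-- The Taylor polynomial at `a` of the jet `(F_{α+β})_{|α| ≤ m - |β|}`. -/
def taylorPoly (m : ℕ) (F : (Fin n → ℕ) → ℝ^n → ℝ) (β : Fin n → ℕ) (a x : ℝ^n) : ℝ :=
  ∑ α ∈ multiIndices n (m - ∑ i, β i), F (α + β) a * taylorMonomial α a x

lemma taylorRem_eq_sub_taylorPoly (m : ℕ) (F : (Fin n → ℕ) → ℝ^n → ℝ) (β : Fin n → ℕ)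
    (x y : ℝ^n) : taylorRem m F β x y = F β y - taylorPoly m F β x y := by
  simp only [taylorRem, taylorPoly, taylorMonomial, multiIndices, mul_div_assoc]

lemma contDiff_taylorMonomial (α : Fin n → ℕ) (a : ℝ^n) {k : ℕ∞ω} :
    ContDiff ℝ k (taylorMonomial α a) := by
  unfold taylorMonomial
  apply ContDiff.div_const
  apply contDiff_prod
  intro i _
  fun_prop

lemma contDiff_taylorPoly (m : ℕ) (F : (Fin n → ℕ) → ℝ^n → ℝ) (β : Fin n → ℕ) (a : ℝ^n)
    {k : ℕ∞ω} : ContDiff ℝ k (taylorPoly m F β a) := by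
  unfold taylorPoly
  exact ContDiff.sum fun α _ => contDiff_const.mul (contDiff_taylorMonomial α a)

lemma fderiv_taylorMonomial (α : Fin n → ℕ) (a x : ℝ^n) (i : Fin n) :
    fderiv ℝ (taylorMonomial α a) x (EuclideanSpace.single i 1) =
      (∏ j ∈ Finset.univ.erase i, (x j - a j) ^ α j) * (α i * (x i - a i) ^ (α i - 1)) /
        ∏ j, ((α j).factorial : ℝ) := by
  have h1 : ∀ j : Fin n, HasFDerivAt (fun y : ℝ^n => (y j - a j) ^ α j)
      ((α j * (x j - a j) ^ (α j - 1)) • EuclideanSpace.proj (𝕜 := ℝ) j) x := by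
    intro j
    have h := ((EuclideanSpace.proj j : ℝ^n →L[ℝ] ℝ).hasFDerivAt
      (x := x)).sub_const (a j)
    exact (h.pow (α j)).congr_fderiv (by ext; simp)
  have h2 := (HasFDerivAt.finsetProd (u := Finset.univ) (fun j _ => h1 j)).mul_const
    (∏ j, ((α j).factorial : ℝ))⁻¹
  have h3 : HasFDerivAt (taylorMonomial α a) _ x := h2
  rw [h3.fderiv]
  simp only [smul_apply, sum_apply, smul_eq_mul,
    PiLp.proj_apply]
  rw [Finset.sum_eq_single i]
  · simp; ring
  · intro j _ hj
    simp [hj]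
  · simp

lemma fderiv_taylorMonomial_of_eq_zero {α : Fin n → ℕ} (a x : ℝ^n) {i : Fin n} (h : α i = 0) :
    fderiv ℝ (taylorMonomial α a) x (EuclideanSpace.single i 1) = 0 := by
  rw [fderiv_taylorMonomial, h]; simp

lemma fderiv_taylorMonomial_add_single (α : Fin n → ℕ) (a x : ℝ^n) (i : Fin n) :
    fderiv ℝ (taylorMonomial (α + Pi.single i 1) a) x (EuclideanSpace.single i 1) =
      taylorMonomial α a x := by
  rw [fderiv_taylorMonomial, taylorMonomial]
  have hne : ∀ j ∈ Finset.univ.erase i, (α + Pi.single i 1 : Fin n → ℕ) j = α j := by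
    intro j hj
    simp [Finset.ne_of_mem_erase hj]
  have e1 := Finset.prod_congr rfl fun j hj => congrArg ((x j - a j) ^ ·) (hne j hj)
  have e2 := Finset.prod_congr rfl fun j hj => congrArg (fun k => (k.factorial : ℝ)) (hne j hj)
  rw [← Finset.prod_erase_mul _ _ (Finset.mem_univ i),
    ← Finset.prod_erase_mul (f := fun j => (x j - a j) ^ α j) _ (Finset.mem_univ i),
    ← Finset.prod_erase_mul (f := fun j => ((α j).factorial : ℝ)) _ (Finset.mem_univ i),
    e1, e2]
  have hi : (α + Pi.single i 1 : Fin n → ℕ) i = α i + 1 := by simp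
  rw [hi, Nat.factorial_succ]
  have h0 : ∏ j ∈ Finset.univ.erase i, ((α j).factorial : ℝ) ≠ 0 :=
    Finset.prod_ne_zero_iff.2 fun j _ => by positivity
  push_cast
  field_simp

lemma sum_add_single (α : Fin n → ℕ) (i : Fin n) :
    ∑ j, (α + Pi.single i 1 : Fin n → ℕ) j = ∑ j, α j + 1 := by
  simp [Finset.sum_add_distrib]

lemma fderiv_taylorPoly (m : ℕ) (F : (Fin n → ℕ) → ℝ^n → ℝ) {β : Fin n → ℕ}
    (hβ : ∑ i, β i < m) (a x : ℝ^n) (i : Fin n) :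
    fderiv ℝ (taylorPoly m F β a) x (EuclideanSpace.single i 1) =
      taylorPoly m F (β + Pi.single i 1) a x := by
  have h1 : HasFDerivAt (taylorPoly m F β a)
      (∑ α ∈ multiIndices n (m - ∑ i, β i), F (α + β) a • fderiv ℝ (taylorMonomial α a) x) x := by
    unfold taylorPoly
    refine HasFDerivAt.fun_sum fun α _ => HasFDerivAt.const_mul ?_ _
    exact ((contDiff_taylorMonomial α a (k := 1)).differentiable (by simp)).differentiableAt.hasFDerivAt
  rw [h1.fderiv]
  simp only [sum_apply, smul_apply, smul_eq_mul]
  unfold taylorPoly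
  symm
  refine Finset.sum_of_injOn (fun α => α + Pi.single i 1) ?_ ?_ ?_ ?_
  · intro α _ α' _ h
    exact add_right_cancel h
  · intro α hα
    simp only [Finset.mem_coe, mem_multiIndices, sum_add_single] at hα ⊢
    omega
  · intro α hα hα'
    rw [fderiv_taylorMonomial_of_eq_zero, mul_zero]
    by_contra h0
    refine hα' ⟨α - Pi.single i 1, ?_, ?_⟩
    · have h2 : α - Pi.single i 1 + Pi.single i 1 = α := by
        ext j
        rcases eq_or_ne j i with rfl | hj
        · simp; omega
        · simp [hj]
      have h3 := sum_add_single (α - Pi.single i 1) i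
      rw [h2] at h3
      simp only [Finset.mem_coe, mem_multiIndices, sum_add_single] at hα ⊢
      omega
    · ext j
      rcases eq_or_ne j i with rfl | hj
      · simp; omega
      · simp [hj]
  · intro α _
    rw [fderiv_taylorMonomial_add_single]
    congr 2
    abel

/-- The multi-index counting the occurrences of each coordinate in `j`. -/
def occurrences {k : ℕ} (j : Fin k → Fin n) : Fin n → ℕ :=
  fun i => (Finset.univ.filter (fun l => j l = i)).card

lemma sum_occurrences {k : ℕ} (j : Fin k → Fin n) : ∑ i, occurrences j i = k := by
  have := Finset.card_eq_sum_card_fiberwise (f := j) (s := Finset.univ) (t := Finset.univ)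
    (by simp)
  simpa [occurrences] using this.symm

lemma occurrences_succ {k : ℕ} (j : Fin (k + 1) → Fin n) :
    occurrences j = occurrences (Fin.tail j) + Pi.single (j 0) 1 := by
  ext i
  simp only [occurrences, Fin.card_filter_univ_succ, Pi.add_apply, Pi.single_apply, Fin.tail]
  split_ifs with h1 h2 h2
  · rfl
  · exact absurd h1.symm h2
  · exact absurd h2.symm h1
  · rfl

lemma iteratedFDeriv_taylorPoly (m : ℕ) (F : (Fin n → ℕ) → ℝ^n → ℝ) (a : ℝ^n) {k : ℕ}
    (hk : k ≤ m) (j : Fin k → Fin n) (x : ℝ^n) :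
    iteratedFDeriv ℝ k (taylorPoly m F 0 a) x (fun l => EuclideanSpace.single (j l) 1) =
      taylorPoly m F (occurrences j) a x := by
  induction k generalizing x with
  | zero =>
    have : occurrences j = 0 := by ext; simp [occurrences]
    simp [this]
  | succ k ih =>
    rw [iteratedFDeriv_succ_apply_left, occurrences_succ,
      ← fderiv_taylorPoly m F (by rw [sum_occurrences]; omega),
      ← fderiv_continuousMultilinear_apply_const_apply]
    · congr 2
      ext y
      exact ih (by omega) (Fin.tail j) y
    · have h : ContDiff ℝ (1 + k) (taylorPoly m F 0 a) := contDiff_taylorPoly m F 0 a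
      exact (h.iteratedFDeriv_right le_rfl).differentiable (by simp) |>.differentiableAt

lemma taylorPoly_self (m : ℕ) (F : (Fin n → ℕ) → ℝ^n → ℝ) (β : Fin n → ℕ) (a : ℝ^n) :
    taylorPoly m F β a a = F β a := by
  rw [taylorPoly, Finset.sum_eq_single 0]
  · simp [taylorMonomial]
  · intro α _ hα
    obtain ⟨i, hi⟩ := Function.ne_iff.1 hα
    rw [taylorMonomial, Finset.prod_eq_zero (Finset.mem_univ i), zero_div, mul_zero]
    simpa using hi
  · intro h
    exact absurd (mem_multiIndices.2 (by simp)) h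

lemma ContinuousMultilinearMap.apply_eq_sum_single {k : ℕ} (M : (ℝ^n)[×k]→L[ℝ] ℝ)
    (v : Fin k → ℝ^n) :
    M v = ∑ j : Fin k → Fin n, (∏ l, v l (j l)) * M (fun l => EuclideanSpace.single (j l) 1) := by
  have hv : v = fun l => ∑ i, v l i • EuclideanSpace.single i (1 : ℝ) := by
    ext l i
    simp [Finset.sum_apply, Pi.single_apply]
  conv_lhs => rw [hv]
  have := M.toMultilinearMap.map_sum (fun l i => v l i • EuclideanSpace.single i (1 : ℝ))
  refine this.trans (Finset.sum_congr rfl fun j _ => ?_)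
  exact M.toMultilinearMap.map_smul_univ _ _

lemma ContinuousMultilinearMap.norm_le_sum_single {k : ℕ} (M : (ℝ^n)[×k]→L[ℝ] ℝ) :
    ‖M‖ ≤ ∑ j : Fin k → Fin n, |M (fun l => EuclideanSpace.single (j l) 1)| := by
  refine M.opNorm_le_bound (by positivity) fun v => ?_
  rw [M.apply_eq_sum_single v, Finset.sum_mul]
  refine (norm_sum_le _ _).trans (Finset.sum_le_sum fun j _ => ?_)
  rw [norm_mul, mul_comm, norm_prod, Real.norm_eq_abs]
  gcongr with l
  exact PiLp.norm_apply_le (v l) (j l)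

lemma iteratedFDeriv_taylorPoly_eq_zero (m : ℕ) (F : (Fin n → ℕ) → ℝ^n → ℝ) (a x : ℝ^n) :
    iteratedFDeriv ℝ (m + 1) (taylorPoly m F 0 a) x = 0 := by
  have h : ∀ y, iteratedFDeriv ℝ m (taylorPoly m F 0 a) y =
      iteratedFDeriv ℝ m (taylorPoly m F 0 a) a := by
    intro y
    ext v
    rw [ContinuousMultilinearMap.apply_eq_sum_single,
      ContinuousMultilinearMap.apply_eq_sum_single (iteratedFDeriv ℝ m _ a)]
    refine Finset.sum_congr rfl fun j _ => ?_
    rw [iteratedFDeriv_taylorPoly _ _ _ le_rfl, iteratedFDeriv_taylorPoly _ _ _ le_rfl]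
    simp only [taylorPoly, sum_occurrences, Nat.sub_self]
    congr 1
    refine Finset.sum_congr rfl fun α hα => ?_
    have : α = 0 := by
      ext i
      have := mem_multiIndices.1 hα
      simp at this
      simp [this]
    simp [this, taylorMonomial]
  have h0 : fderiv ℝ (iteratedFDeriv ℝ m (taylorPoly m F 0 a)) x = 0 := by
    rw [funext h]
    exact fderiv_const_apply _
  rw [← norm_eq_zero, ← norm_fderiv_iteratedFDeriv, h0]
  exact norm_zero (E := ℝ^n →L[ℝ] (ℝ^n)[×m]→L[ℝ] ℝ)

end TaylorPolynomials

section PartitionOfUnity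

lemma isOpen_setOf_pos {M : Type*} [PseudoMetricSpace M] {d : M → ℝ}
    (hd : ∀ x y, d x ≤ d y + dist x y) : IsOpen {x | 0 < d x} :=
  isOpen_lt continuous_const (LipschitzWith.of_le_add hd).continuous

/-- A maximal family of points which are separated at the scale given by `d`. -/
lemma exists_separated_net {M : Type*} [PseudoMetricSpace M] {d : M → ℝ}
    (hd : ∀ x y, d x ≤ d y + dist x y) :
    ∃ S : Set M, (∀ s ∈ S, 0 < d s) ∧ S.Pairwise (fun s t => d s ≤ 20 * dist s t) ∧
      ∀ x, 0 < d x → ∃ s ∈ S, 19 * dist x s ≤ d s := by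
  obtain ⟨S, hS⟩ := zorn_subset
    {S : Set M | (∀ s ∈ S, 0 < d s) ∧ S.Pairwise (fun s t => d s ≤ 20 * dist s t)} (by
      intro c hc hchain
      refine ⟨⋃₀ c, ⟨?_, ?_⟩, fun s hs => subset_sUnion_of_mem hs⟩
      · rintro s ⟨t, ht, hst⟩
        exact (hc ht).1 s hst
      · exact (pairwise_sUnion hchain.directedOn).2 fun t ht => (hc ht).2)
  refine ⟨S, hS.1.1, hS.1.2, fun x hx => ?_⟩
  by_contra! hcon
  have hxS : x ∉ S := fun h => by
    have := hcon x h
    simp at this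
    linarith
  have hins : insert x S ⊆ S := hS.2 (y := insert x S) ⟨?_, ?_⟩ (subset_insert _ _)
  · exact hxS (hins (mem_insert _ _))
  · rintro s (rfl | hs)
    exacts [hx, hS.1.1 s hs]
  · refine (pairwise_insert_of_notMem hxS).2 ⟨hS.1.2, fun s hs => ?_⟩
    have h1 := hcon s hs
    have h2 := hd x s
    have h3 := dist_nonneg (x := x) (y := s)
    rw [dist_comm s x]
    constructor <;> linarith

variable {E : Type*} [NormedAddCommGroup E] [NormedSpace ℝ E]

/-- `g` satisfies `‖D^k g‖ ≤ C d^{-k}` for `k ≤ m` on the region where `d` is positive. -/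
def SymbolBound (d : E → ℝ) (m : ℕ) (C : ℝ) (g : E → ℝ) : Prop :=
  ∀ k ≤ m, ∀ x, 0 < d x → ‖iteratedFDeriv ℝ k g x‖ ≤ C / d x ^ k

variable {d : E → ℝ}

lemma norm_iteratedFDeriv_mul_le_of_isOpen {Ω : Set E} (hΩ : IsOpen Ω) {g h : E → ℝ}
    (hg : ContDiffOn ℝ ∞ g Ω) (hh : ContDiffOn ℝ ∞ h Ω) {x : E} (hx : x ∈ Ω) (k : ℕ) :
    ‖iteratedFDeriv ℝ k (fun y => g y * h y) x‖ ≤ ∑ i ∈ Finset.range (k + 1),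
      (k.choose i : ℝ) * ‖iteratedFDeriv ℝ i g x‖ * ‖iteratedFDeriv ℝ (k - i) h x‖ := by
  have := norm_iteratedFDerivWithin_mul_le hg hh hΩ.uniqueDiffOn hx (n := k)
    (by exact_mod_cast le_top)
  simpa only [iteratedFDerivWithin_of_isOpen _ hΩ hx] using this

lemma sum_choose_mul_le (k : ℕ) {C₁ C₂ r : ℝ} (hr : 0 < r) {u v : ℕ → ℝ} (hu0 : ∀ i, 0 ≤ u i)
    (hv0 : ∀ i, 0 ≤ v i) (hu : ∀ i ≤ k, u i ≤ C₁ / r ^ i) (hv : ∀ i ≤ k, v i ≤ C₂ / r ^ i) :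
    ∑ i ∈ Finset.range (k + 1), (k.choose i : ℝ) * u i * v (k - i) ≤
      2 ^ k * C₁ * C₂ / r ^ k := by
  have h2 : (2 : ℝ) ^ k = ∑ i ∈ Finset.range (k + 1), (k.choose i : ℝ) := by
    exact_mod_cast (Nat.sum_range_choose k).symm
  rw [h2, Finset.sum_mul, Finset.sum_mul, Finset.sum_div]
  refine Finset.sum_le_sum fun i hi => ?_
  have hik : i ≤ k := Nat.lt_succ_iff.1 (Finset.mem_range.1 hi)
  have hr' : r ^ k = r ^ i * r ^ (k - i) := by rw [← pow_add]; congr 1; omega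
  calc (k.choose i : ℝ) * u i * v (k - i)
      = k.choose i * (u i * v (k - i)) := by ring
    _ ≤ k.choose i * (C₁ / r ^ i * (C₂ / r ^ (k - i))) := by
        gcongr
        · exact hv0 _
        · exact (hu0 i).trans (hu i hik)
        · exact hu i hik
        · exact hv _ (Nat.sub_le _ _)
    _ = k.choose i * C₁ * C₂ / r ^ k := by rw [hr']; field_simp

lemma SymbolBound.mul (hd : ∀ x y, d x ≤ d y + dist x y) {m : ℕ} {C₁ C₂ : ℝ} {g h : E → ℝ}
    (hg : SymbolBound d m C₁ g) (hh : SymbolBound d m C₂ h)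
    (hgs : ContDiffOn ℝ ∞ g {x | 0 < d x}) (hhs : ContDiffOn ℝ ∞ h {x | 0 < d x})
    (hC₁ : 0 ≤ C₁) (hC₂ : 0 ≤ C₂) :
    SymbolBound d m (2 ^ m * C₁ * C₂) (fun x => g x * h x) := by
  intro k hk x hx
  refine (norm_iteratedFDeriv_mul_le_of_isOpen (isOpen_setOf_pos hd) hgs hhs hx k).trans ?_
  refine (sum_choose_mul_le k hx (u := fun i => ‖iteratedFDeriv ℝ i g x‖)
    (v := fun i => ‖iteratedFDeriv ℝ i h x‖) (fun _ => norm_nonneg _) (fun _ => norm_nonneg _)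
    (fun i hi => hg i (hi.trans hk) x hx) (fun i hi => hh i (hi.trans hk) x hx)).trans ?_
  gcongr
  exact one_le_two

lemma SymbolBound.inv (hd : ∀ x y, d x ≤ d y + dist x y) {m : ℕ} {B : ℝ} {g : E → ℝ}
    (hg : SymbolBound d m B g) (hgs : ContDiffOn ℝ ∞ g {x | 0 < d x})
    (hg1 : ∀ x, 0 < d x → 1 ≤ g x) :
    ∃ C, 0 ≤ C ∧ SymbolBound d m C (fun x => (g x)⁻¹) := by
  have hinv : ContDiffOn ℝ ∞ (fun t : ℝ => t⁻¹) (Ioi 0) := fun t ht =>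
    (contDiffAt_inv ℝ (ne_of_gt ht)).contDiffWithinAt
  have hbound : ∀ i : ℕ, ∃ C, ∀ t ∈ Icc 1 B,
      ‖iteratedFDerivWithin ℝ i (fun t : ℝ => t⁻¹) (Ioi 0) t‖ ≤ C := fun i =>
    isCompact_Icc.exists_bound_of_continuousOn
      ((hinv.continuousOn_iteratedFDerivWithin (by exact_mod_cast le_top)
        isOpen_Ioi.uniqueDiffOn).mono fun t ht => zero_lt_one.trans_le ht.1)
  choose c hc using hbound
  set c' : ℝ := ∑ i ∈ Finset.range (m + 1), |c i|
  set M : ℝ := max B 1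
  have hM : 1 ≤ M := le_max_right _ _
  refine ⟨m.factorial * c' * M ^ m, by positivity, fun k hk x hx => ?_⟩
  have hΩ := isOpen_setOf_pos hd
  have key := norm_iteratedFDerivWithin_comp_le (n := k) (C := c') (D := M / d x) hinv hgs
    (by exact_mod_cast le_top) isOpen_Ioi.uniqueDiffOn hΩ.uniqueDiffOn
    (fun y hy => zero_lt_one.trans_le (hg1 y hy)) hx ?_ ?_
  · rw [iteratedFDerivWithin_of_isOpen _ hΩ hx] at key
    refine key.trans ?_
    rw [div_pow, mul_div_assoc']
    gcongr
  · intro i hi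
    refine (hc i (g x) ⟨hg1 x hx, ?_⟩).trans ((le_abs_self _).trans ?_)
    · have h0 := hg 0 (Nat.zero_le _) x hx
      rw [norm_iteratedFDeriv_zero, pow_zero, div_one] at h0
      exact (le_abs_self _).trans h0
    · exact Finset.single_le_sum (f := fun i => |c i|) (fun _ _ => abs_nonneg _)
        (Finset.mem_range.2 (by omega))
  · intro i hi1 hi
    rw [iteratedFDerivWithin_of_isOpen _ hΩ hx, div_pow]
    refine (hg i (hi.trans hk) x hx).trans ?_
    gcongr
    exact (le_max_left _ _).trans (le_self_pow₀ hM (by omega))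

lemma finite_separated_near [FiniteDimensional ℝ E] (hd : ∀ x y, d x ≤ d y + dist x y)
    {S : Set E} (hS : S.Pairwise (fun s t => d s ≤ 20 * dist s t)) {x : E} (hx : 0 < d x) :
    ∃ A : Finset E, A.card ≤ 5 ^ Module.finrank ℝ E ∧
      ∀ s, s ∈ A ↔ s ∈ S ∧ 16 * dist x s ≤ d s := by
  classical
  have hcard : ∀ t : Finset E, (∀ s ∈ t, s ∈ S ∧ 16 * dist x s ≤ d s) →
      t.card ≤ 5 ^ Module.finrank ℝ E := by
    intro t ht
    have hr : 0 < 30 / d x := by positivity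
    have hinj : Function.Injective fun s : E => (30 / d x) • (s - x) := fun s t h =>
      sub_left_injective (smul_right_injective E hr.ne' h)
    rw [← Finset.card_image_of_injective t hinj]
    refine Besicovitch.card_le_of_separated _ ?_ ?_
    · simp only [Finset.mem_image, forall_exists_index, and_imp]
      rintro _ s hs rfl
      rw [norm_smul, Real.norm_of_nonneg hr.le, ← dist_eq_norm, dist_comm, div_mul_eq_mul_div,
        div_le_iff₀ hx]
      have h1 := (ht s hs).2
      have h2 := hd s x
      rw [dist_comm] at h2
      linarith
    · simp only [Finset.mem_image, forall_exists_index, and_imp]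
      rintro _ s hs rfl _ s' hs' rfl hne
      have hss' : s ≠ s' := fun h => hne (by rw [h])
      rw [← smul_sub, sub_sub_sub_cancel_right, norm_smul, Real.norm_of_nonneg hr.le,
        ← dist_eq_norm, div_mul_eq_mul_div, le_div_iff₀ hx]
      have h1 := hS (ht s hs).1 (ht s' hs').1 hss'
      have h2 := hd x s
      have h3 := (ht s hs).2
      linarith
  have hfin : {s | s ∈ S ∧ 16 * dist x s ≤ d s}.Finite := by
    by_contra hinf
    obtain ⟨t, ht, htc⟩ := Set.Infinite.exists_subset_card_eq hinf (5 ^ Module.finrank ℝ E + 1)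
    have := hcard t fun s hs => ht hs
    omega
  refine ⟨hfin.toFinset, hcard _ fun s hs => by simpa using hs, fun s => by simp⟩

lemma norm_iteratedFDeriv_rescale {g : E → ℝ} (hg : ContDiff ℝ ∞ g) (k : ℕ) {r : ℝ} (hr : 0 < r)
    (s x : E) : ‖iteratedFDeriv ℝ k (fun y => g (r⁻¹ • (y - s))) x‖ =
      ‖iteratedFDeriv ℝ k g (r⁻¹ • (x - s))‖ / r ^ k := by
  rw [iteratedFDeriv_comp_sub (f := fun y => g (r⁻¹ • y)),
    iteratedFDeriv_comp_const_smul (i := k) _ (hg.of_le (by exact_mod_cast le_top)),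
    norm_smul, norm_pow, Real.norm_of_nonneg (by positivity), inv_pow, mul_comm, div_eq_mul_inv]

/-- A family of bump functions adapted to the scale `d`, with locally finite sum `≥ 1`. -/
lemma exists_adapted_bumps [FiniteDimensional ℝ E] (hd : ∀ x y, d x ≤ d y + dist x y) (m : ℕ) :
    ∃ (S : Set E) (η : E → E → ℝ) (N : ℕ) (C : ℝ), 0 ≤ C ∧ (∀ s ∈ S, 0 < d s) ∧
      (∀ s, ContDiff ℝ ∞ (η s)) ∧ (∀ s, SymbolBound d m C (η s)) ∧
      (∀ s y, 0 ≤ η s y) ∧ (∀ y, 0 < d y → ∃ s ∈ S, 1 ≤ η s y) ∧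
      ∀ x, 0 < d x → ∃ A : Finset E, A.card ≤ N ∧ (∀ s ∈ A, s ∈ S ∧ 16 * dist x s ≤ d s) ∧
        ∀ᶠ y in 𝓝 x, ∀ s, s ∉ A → η s y = 0 := by
  classical
  obtain ⟨S, hSpos, hSsep, hScov⟩ := exists_separated_net hd
  let ψ : ContDiffBump (0 : E) := ⟨1 / 19, 1 / 18, by norm_num, by norm_num⟩
  have hψ : ContDiff ℝ ∞ ψ := ψ.contDiff
  have hψb : ∀ k : ℕ, ∃ c, ∀ x, ‖iteratedFDeriv ℝ k ψ x‖ ≤ c := fun k =>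
    (hψ.continuous_iteratedFDeriv (by exact_mod_cast le_top)).bounded_above_of_compact_support
      (ψ.hasCompactSupport.iteratedFDeriv k)
  choose c hc using hψb
  set c' : ℝ := ∑ i ∈ Finset.range (m + 1), |c i|
  let η : E → E → ℝ := fun s y => if s ∈ S then ψ ((d s)⁻¹ • (y - s)) else 0
  have hη0 : ∀ s y, d s ≤ 18 * dist y s → η s y = 0 := by
    intro s y h
    simp only [η]
    split_ifs with hs
    · refine ψ.zero_of_le_dist ?_
      have hs0 := hSpos s hs
      rw [dist_zero_right, norm_smul, norm_inv, Real.norm_of_nonneg hs0.le, ← dist_eq_norm,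
        inv_mul_eq_div, le_div_iff₀ hs0]
      change 1 / 18 * d s ≤ _
      linarith
    · rfl
  have hηs : ∀ s, ContDiff ℝ ∞ (η s) := by
    intro s
    by_cases hs : s ∈ S
    · simp only [η, hs, if_true]
      exact hψ.comp (contDiff_const.smul (contDiff_id.sub contDiff_const))
    · simp only [η, hs, if_false]
      exact contDiff_const
  have hloc : ∀ x, 0 < d x → ∀ᶠ y in 𝓝 x, ∀ s, d s < 16 * dist x s → η s y = 0 := by
    intro x hx
    filter_upwards [ball_mem_nhds x (by positivity : 0 < d x / 1000)] with y hy s hs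
    refine hη0 s y ?_
    have h1 := hd x s
    have h2 := dist_triangle x y s
    rw [mem_ball, dist_comm] at hy
    linarith
  refine ⟨S, η, 5 ^ Module.finrank ℝ E, 2 ^ m * c', by positivity, hSpos, hηs, ?_, ?_, ?_, ?_⟩
  · intro s k hk x hx
    by_cases h : s ∈ S ∧ 16 * dist x s ≤ d s
    · have hs0 := hSpos s h.1
      have heq : η s = fun y => ψ ((d s)⁻¹ • (y - s)) := by
        ext y
        simp only [η, h.1, if_true]
      rw [heq, norm_iteratedFDeriv_rescale hψ k hs0]
      have hck : c k ≤ c' := (le_abs_self _).trans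
        (Finset.single_le_sum (f := fun i => |c i|) (fun _ _ => abs_nonneg _)
          (Finset.mem_range.2 (by omega)))
      have hdx : d x / 2 ≤ d s := by
        have := hd x s
        linarith [h.2]
      have hc0 : 0 ≤ c' := by positivity
      calc _ ≤ c' / (d x / 2) ^ k := by
            gcongr
            exact (hc k _).trans hck
        _ = 2 ^ k * c' / d x ^ k := by rw [div_pow]; field_simp
        _ ≤ _ := by
            gcongr
            exact one_le_two
    · have hev : η s =ᶠ[𝓝 x] fun _ => 0 := by
        by_cases hs : s ∈ S
        · filter_upwards [hloc x hx] with y hy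
          exact hy s (not_le.1 fun h' => h ⟨hs, h'⟩)
        · exact Eventually.of_forall fun y => by simp only [η, hs, if_false]
      rw [(hev.iteratedFDeriv ℝ k).eq_of_nhds, iteratedFDeriv_fun_zero]
      simp only [Pi.zero_apply, norm_zero]
      positivity
  · intro s y
    simp only [η]
    split_ifs
    exacts [ψ.nonneg, le_rfl]
  · intro y hy
    obtain ⟨s, hs, hys⟩ := hScov y hy
    refine ⟨s, hs, ?_⟩
    simp only [η, hs, if_true]
    refine (ψ.one_of_mem_closedBall ?_).ge
    have hs0 := hSpos s hs
    rw [mem_closedBall, dist_zero_right, norm_smul, norm_inv, Real.norm_of_nonneg hs0.le,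
      ← dist_eq_norm, inv_mul_eq_div, div_le_iff₀ hs0]
    change _ ≤ 1 / 19 * d s
    linarith
  · intro x hx
    obtain ⟨A, hAc, hA⟩ := finite_separated_near hd hSsep hx
    refine ⟨A, hAc, fun s hs => (hA s).1 hs, ?_⟩
    filter_upwards [hloc x hx] with y hy s hs
    by_cases hsS : s ∈ S
    · exact hy s (not_le.1 fun h => hs ((hA s).2 ⟨hsS, h⟩))
    · simp only [η, hsS, if_false]

/-- A Whitney-type partition of unity at the scale given by a `1`-Lipschitz function `d`. -/
theorem exists_adapted_partitionOfUnity [FiniteDimensional ℝ E]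
    (hd : ∀ x y, d x ≤ d y + dist x y) (m : ℕ) :
    ∃ (S : Set E) (φ : E → E → ℝ) (N : ℕ) (C : ℝ), 0 ≤ C ∧ (∀ s ∈ S, 0 < d s) ∧
      (∀ s, ContDiffOn ℝ ∞ (φ s) {x | 0 < d x}) ∧ (∀ s, SymbolBound d m C (φ s)) ∧
      ∀ x, 0 < d x → ∃ A : Finset E, A.card ≤ N ∧ (∀ s ∈ A, s ∈ S ∧ 16 * dist x s ≤ d s) ∧
        ∀ᶠ y in 𝓝 x, (∀ s, s ∉ A → φ s y = 0) ∧ ∑ s ∈ A, φ s y = 1 := by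
  obtain ⟨S, η, N, C, hC, hSpos, hηs, hηb, hη0, hη1, hA⟩ := exists_adapted_bumps hd m
  let Φ : E → ℝ := fun y => ∑ᶠ s, η s y
  have hΩ := isOpen_setOf_pos hd
  have hΦeq : ∀ (A : Finset E) y, (∀ s, s ∉ A → η s y = 0) → Φ y = ∑ s ∈ A, η s y := by
    intro A y h
    refine finsum_eq_sum_of_support_subset _ fun s hs => ?_
    by_contra hsA
    exact hs (h s hsA)
  have hΦ1 : ∀ x, 0 < d x → 1 ≤ Φ x := by
    intro x hx
    obtain ⟨A, -, -, hev⟩ := hA x hx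
    have hx0 := hev.self_of_nhds
    obtain ⟨s, hs, h1⟩ := hη1 x hx
    have hsA : s ∈ A := by
      by_contra h
      linarith [hx0 s h]
    rw [hΦeq A x hx0]
    exact h1.trans (Finset.single_le_sum (f := fun s => η s x) (fun s _ => hη0 s x) hsA)
  have hΦev : ∀ x, 0 < d x → ∃ A : Finset E, A.card ≤ N ∧ Φ =ᶠ[𝓝 x] ∑ s ∈ A, η s := by
    intro x hx
    obtain ⟨A, hAc, -, hev⟩ := hA x hx
    refine ⟨A, hAc, ?_⟩
    filter_upwards [hev] with y hy
    rw [hΦeq A y hy, Finset.sum_apply]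
  have hΦs : ContDiffOn ℝ ∞ Φ {x | 0 < d x} := by
    intro x hx
    obtain ⟨A, -, hev⟩ := hΦev x hx
    refine ContDiffAt.contDiffWithinAt (ContDiffAt.congr_of_eventuallyEq ?_ hev)
    have : ContDiff ℝ ∞ (∑ s ∈ A, η s) := by
      rw [show ∑ s ∈ A, η s = fun y => ∑ s ∈ A, η s y from funext fun y => Finset.sum_apply _ _ _]
      exact ContDiff.sum fun s _ => hηs s
    exact this.contDiffAt
  have hΦb : SymbolBound d m (N * C) Φ := by
    intro k hk x hx
    obtain ⟨A, hAc, hev⟩ := hΦev x hx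
    rw [(hev.iteratedFDeriv ℝ k).eq_of_nhds, iteratedFDeriv_sum_apply fun s _ =>
      (hηs s).contDiffAt.of_le (by exact_mod_cast le_top)]
    refine (norm_sum_le_of_le A fun s _ => hηb s k hk x hx).trans ?_
    rw [Finset.sum_const, nsmul_eq_mul, mul_div_assoc]
    gcongr
  obtain ⟨C', hC', hinv⟩ := hΦb.inv hd hΦs hΦ1
  have hinvs : ContDiffOn ℝ ∞ (fun x => (Φ x)⁻¹) {x | 0 < d x} :=
    hΦs.inv fun x hx => (zero_lt_one.trans_le (hΦ1 x hx)).ne'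
  refine ⟨S, fun s y => η s y * (Φ y)⁻¹, N, 2 ^ m * C * C', by positivity, hSpos,
    fun s => (hηs s).contDiffOn.mul hinvs,
    fun s => (hηb s).mul hd hinv (hηs s).contDiffOn hinvs hC hC', fun x hx => ?_⟩
  obtain ⟨A, hAc, hAS, hev⟩ := hA x hx
  refine ⟨A, hAc, hAS, ?_⟩
  filter_upwards [hev, hΩ.mem_nhds hx] with y hy hyΩ
  refine ⟨fun s hs => by rw [hy s hs, zero_mul], ?_⟩
  rw [← Finset.sum_mul, ← hΦeq A y hy]
  exact mul_inv_cancel₀ (zero_lt_one.trans_le (hΦ1 y hyΩ)).ne'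

end PartitionOfUnity

section Extension

variable {E : Type*} [NormedAddCommGroup E] [NormedSpace ℝ E]

lemma ContDiffAt.hasFDerivAt_iteratedFDeriv {g : E → ℝ} {x : E} (hg : ContDiffAt ℝ ∞ g x) (k : ℕ) :
    HasFDerivAt (iteratedFDeriv ℝ k g) (iteratedFDeriv ℝ (k + 1) g x).curryLeft x := by
  have h : ContDiffAt ℝ 1 (iteratedFDeriv ℝ k g) x :=
    hg.iteratedFDeriv_right (by exact_mod_cast le_top)
  exact (h.differentiableAt (by simp)).hasFDerivAt

lemma norm_iteratedFDeriv_le_of_polynomial {Q : E → ℝ} (hQ : ContDiff ℝ ∞ Q) {m : ℕ}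
    (hQ0 : ∀ x, iteratedFDeriv ℝ (m + 1) Q x = 0) {b : E} {ε ρ : ℝ} (hε : 0 ≤ ε)
    (hb : ∀ k ≤ m, ‖iteratedFDeriv ℝ k Q b‖ ≤ ε * ρ ^ (m - k)) {k : ℕ} (hk : k ≤ m) {x : E}
    (hx : dist x b ≤ ρ) : ‖iteratedFDeriv ℝ k Q x‖ ≤ (m + 1) * ε * ρ ^ (m - k) := by
  have hρ : 0 ≤ ρ := dist_nonneg.trans hx
  have hdiff : ∀ k x, DifferentiableAt ℝ (iteratedFDeriv ℝ k Q) x := fun k x =>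
    (hQ.contDiffAt.hasFDerivAt_iteratedFDeriv k).differentiableAt
  have step : ∀ k ≤ m, ∀ B, (∀ y, dist y b ≤ ρ → ‖iteratedFDeriv ℝ (k + 1) Q y‖ ≤ B) →
      ∀ x, dist x b ≤ ρ → ‖iteratedFDeriv ℝ k Q x‖ ≤ ε * ρ ^ (m - k) + B * ρ := by
    intro k hk B hB x hx
    have h1 := (convex_closedBall b ρ).norm_image_sub_le_of_norm_fderiv_le
      (f := iteratedFDeriv ℝ k Q) (𝕜 := ℝ) (C := B) (fun y _ => hdiff k y)
      (fun y hy => norm_fderiv_iteratedFDeriv.trans_le (hB y hy)) (mem_closedBall_self hρ)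
      (mem_closedBall.2 hx)
    have hB0 : 0 ≤ B := (norm_nonneg _).trans (hB b (by simpa using hρ))
    rw [← dist_eq_norm x b] at h1
    have h2 : B * dist x b ≤ B * ρ := by gcongr
    have h3 := norm_le_norm_add_norm_sub' (iteratedFDeriv ℝ k Q x) (iteratedFDeriv ℝ k Q b)
    linarith [hb k hk]
  have main : ∀ j k, k + j = m → ∀ x, dist x b ≤ ρ →
      ‖iteratedFDeriv ℝ k Q x‖ ≤ (j + 1) * ε * ρ ^ j := by
    intro j
    induction j with
    | zero =>
      rintro k rfl x hx
      have := step k le_rfl 0 (fun y _ => by rw [hQ0, norm_zero]) x hx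
      simpa using this
    | succ j ih =>
      intro k hkj x hx
      have := step k (by omega) _ (ih (k + 1) (by omega)) x hx
      rw [show m - k = j + 1 by omega] at this
      refine this.trans_eq ?_
      push_cast
      ring
  refine (main (m - k) k (by omega) x hx).trans ?_
  gcongr
  exact Nat.sub_le _ _

/-- The Whitney estimate with constants `ε`, `δ` on `K` for a field of polynomials `T`, where `T a`
is the prescribed Taylor polynomial at `a`. -/
def WhitneyEstimate (m : ℕ) (T : E → E → ℝ) (K : Set E) (ε δ : ℝ) : Prop :=
  ∀ a ∈ K, ∀ b ∈ K, dist a b ≤ δ → ∀ k ≤ m,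
    ‖iteratedFDeriv ℝ k (T b) b - iteratedFDeriv ℝ k (T a) b‖ ≤ ε * dist a b ^ (m - k)

variable {m : ℕ} {T : E → E → ℝ}

lemma WhitneyEstimate.norm_iteratedFDeriv_sub_le {K : Set E} {ε δ : ℝ}
    (h : WhitneyEstimate m T K ε δ) (hT : ∀ a, ContDiff ℝ ∞ (T a))
    (hT0 : ∀ a x, iteratedFDeriv ℝ (m + 1) (T a) x = 0) (hε : 0 ≤ ε) {a b : E} (ha : a ∈ K)
    (hb : b ∈ K) (hab : dist a b ≤ δ) {ρ : ℝ} (habρ : dist a b ≤ ρ) {x : E} (hx : dist x b ≤ ρ)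
    {k : ℕ} (hk : k ≤ m) :
    ‖iteratedFDeriv ℝ k (T b - T a) x‖ ≤ (m + 1) * ε * ρ ^ (m - k) := by
  have hsub : ∀ k x, iteratedFDeriv ℝ k (T b - T a) x =
      iteratedFDeriv ℝ k (T b) x - iteratedFDeriv ℝ k (T a) x := fun k x =>
    iteratedFDeriv_sub_apply ((hT b).contDiffAt.of_le (by exact_mod_cast le_top))
      ((hT a).contDiffAt.of_le (by exact_mod_cast le_top))
  refine norm_iteratedFDeriv_le_of_polynomial (Q := T b - T a) ((hT b).sub (hT a))
    (fun x => by rw [hsub, hT0, hT0, sub_zero]) hε (fun k hk => ?_) hk hx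
  rw [hsub]
  refine (h a ha b hb hab k hk).trans ?_
  gcongr

/-- Whitney's extension operator: away from `X` the extension of a field of polynomials is smooth
and its derivatives are close to those of the polynomials attached to nearby points. -/
lemma exists_extension_near_polynomials [FiniteDimensional ℝ E] {X : Set E} (hX : X.Nonempty)
    (hT : ∀ a, ContDiff ℝ ∞ (T a)) (hT0 : ∀ a x, iteratedFDeriv ℝ (m + 1) (T a) x = 0) :
    ∃ (f : E → ℝ) (C : ℝ), 0 ≤ C ∧ (∀ x ∈ X, f x = T x x) ∧
      ContDiffOn ℝ ∞ f {x | 0 < infDist x X} ∧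
      ∀ K ε δ, 0 ≤ ε → WhitneyEstimate m T K ε δ → ∀ x, 0 < infDist x X →
        closedBall x (3 * infDist x X) ∩ X ⊆ K → 5 * infDist x X ≤ δ →
        ∃ b ∈ X, dist x b ≤ 2 * infDist x X ∧ ∀ k ≤ m,
          ‖iteratedFDeriv ℝ k f x - iteratedFDeriv ℝ k (T b) x‖ ≤
            C * ε * infDist x X ^ (m - k) := by
  classical
  set d : E → ℝ := fun x => infDist x X
  have hd : ∀ x y, d x ≤ d y + dist x y := fun x y => infDist_le_infDist_add_dist
  have hΩ := isOpen_setOf_pos hd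
  obtain ⟨S, φ, N, C, hC, hSpos, hφs, hφb, hA⟩ := exists_adapted_partitionOfUnity hd m
  have hnear : ∀ x, ∃ b ∈ X, 0 < d x → dist x b ≤ 2 * d x := by
    intro x
    by_cases hx : 0 < d x
    · obtain ⟨b, hb, hxb⟩ := (infDist_lt_iff hX).1 (by linarith : infDist x X < 2 * d x)
      exact ⟨b, hb, fun _ => hxb.le⟩
    · obtain ⟨b, hb⟩ := hX
      exact ⟨b, hb, fun h => absurd h hx⟩
  choose p hpX hp using hnear
  let f : E → ℝ := fun x => if x ∈ X then T x x else ∑ᶠ s, φ s x * T (p s) x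
  have hXΩ : ∀ x, 0 < d x → x ∉ X := fun x hx h => hx.ne' (infDist_zero_of_mem h)
  have hfeq : ∀ (A : Finset E) y, 0 < d y → (∀ s, s ∉ A → φ s y = 0) →
      f y = ∑ s ∈ A, φ s y * T (p s) y := by
    intro A y hy h
    simp only [f, hXΩ y hy, if_false]
    refine finsum_eq_sum_of_support_subset _ fun s hs => ?_
    by_contra hsA
    exact hs (by simp only [h s hsA, zero_mul])
  have hfs : ContDiffOn ℝ ∞ f {x | 0 < d x} := by
    intro x hx
    obtain ⟨A, -, -, hev⟩ := hA x hx
    refine ContDiffAt.contDiffWithinAt (ContDiffAt.congr_of_eventuallyEq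
      (f := fun y => ∑ s ∈ A, φ s y * T (p s) y) ?_ ?_)
    · exact ContDiffAt.sum fun s _ =>
        ((hφs s).contDiffAt (hΩ.mem_nhds hx)).mul (hT (p s)).contDiffAt
    · filter_upwards [hev, hΩ.mem_nhds hx] with y hy hyΩ
      exact hfeq A y hyΩ hy.1
  refine ⟨f, N * (2 ^ m * C * ((m + 1) * 5 ^ m)), by positivity, fun x hx => by simp [f, hx], hfs,
    fun K ε δ hε hW x hx hK hδ => ⟨p x, hpX x, hp x hx, fun k hk => ?_⟩⟩
  change 0 < d x at hx
  change 5 * d x ≤ δ at hδ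
  obtain ⟨A, hAc, hAS, hev⟩ := hA x hx
  set b := p x
  have hxb : dist x b ≤ 2 * d x := hp x hx
  have hbK : b ∈ K := hK ⟨by rw [mem_closedBall, dist_comm]; change _ ≤ 3 * d x; linarith, hpX x⟩
  have hfsub : f - T b =ᶠ[𝓝 x] ∑ s ∈ A, fun y => φ s y * (T (p s) - T b) y := by
    filter_upwards [hev, hΩ.mem_nhds hx] with y hy hyΩ
    rw [Pi.sub_apply, hfeq A y hyΩ hy.1, Finset.sum_apply]
    simp only [Pi.sub_apply, mul_sub]
    rw [Finset.sum_sub_distrib, ← Finset.sum_mul, hy.2, one_mul]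
  have hQs : ∀ s, ContDiff ℝ ∞ (T (p s) - T b) := fun s => (hT _).sub (hT _)
  have hterm : ∀ s ∈ A, ‖iteratedFDeriv ℝ k (fun y => φ s y * (T (p s) - T b) y) x‖ ≤
      2 ^ k * C * ((m + 1) * ε * 5 ^ m * d x ^ m) / d x ^ k := by
    intro s hs
    obtain ⟨hsS, hxs⟩ := hAS s hs
    have hs0 := hSpos s hsS
    have h1 := hd s x
    rw [dist_comm] at h1
    have h2 := hp s hs0
    have h3 := dist_triangle x s (p s)
    have h4 := dist_triangle b x (p s)
    rw [dist_comm b x] at h4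
    have hpK : p s ∈ K :=
      hK ⟨by rw [mem_closedBall, dist_comm]; change _ ≤ 3 * d x; linarith, hpX s⟩
    refine (norm_iteratedFDeriv_mul_le_of_isOpen hΩ (hφs s) (hQs s).contDiffOn hx k).trans ?_
    refine sum_choose_mul_le k hx (u := fun i => ‖iteratedFDeriv ℝ i (φ s) x‖)
      (v := fun i => ‖iteratedFDeriv ℝ i (T (p s) - T b) x‖)
      (fun _ => norm_nonneg _) (fun _ => norm_nonneg _)
      (fun i hi => hφb s i (hi.trans hk) x hx) (fun i hi => ?_)
    have him := hi.trans hk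
    refine (hW.norm_iteratedFDeriv_sub_le hT hT0 hε hbK hpK (ρ := 5 * d x) (by linarith)
      (by linarith) (by linarith) him).trans ?_
    rw [mul_pow, le_div_iff₀ (by positivity)]
    calc (m + 1) * ε * (5 ^ (m - i) * d x ^ (m - i)) * d x ^ i
        = (m + 1) * ε * 5 ^ (m - i) * (d x ^ (m - i) * d x ^ i) := by ring
      _ = (m + 1) * ε * 5 ^ (m - i) * d x ^ m := by rw [← pow_add, Nat.sub_add_cancel him]
      _ ≤ (m + 1) * ε * 5 ^ m * d x ^ m := by
          gcongr
          · norm_num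
          · exact Nat.sub_le _ _
  have hle : ((k : ℕ∞) : ℕ∞ω) ≤ ∞ := by exact_mod_cast le_top
  rw [← iteratedFDeriv_sub_apply ((hfs.contDiffAt (hΩ.mem_nhds hx)).of_le hle)
    ((hT b).contDiffAt.of_le hle), (hfsub.iteratedFDeriv ℝ k).eq_of_nhds,
    iteratedFDeriv_sum_apply fun s _ => (((hφs s).contDiffAt (hΩ.mem_nhds hx)).mul
      (hQs s).contDiffAt).of_le hle]
  refine (norm_sum_le_of_le A hterm).trans ?_
  rw [Finset.sum_const, nsmul_eq_mul]
  change _ ≤ _ * d x ^ (m - k)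
  have hpow : d x ^ m = d x ^ (m - k) * d x ^ k := by rw [← pow_add, Nat.sub_add_cancel hk]
  calc (A.card : ℝ) * (2 ^ k * C * ((m + 1) * ε * 5 ^ m * d x ^ m) / d x ^ k)
      = A.card * (2 ^ k * C * ((m + 1) * 5 ^ m)) * ε * d x ^ (m - k) := by
        rw [hpow]; field_simp
    _ ≤ N * (2 ^ m * C * ((m + 1) * 5 ^ m)) * ε * d x ^ (m - k) := by
        gcongr
        exact one_le_two

/-- Whitney's extension theorem for a field of polynomials `T` of degree at most `m`. -/
theorem exists_contDiffOn_extension [FiniteDimensional ℝ E] {U X : Set E} (hU : IsOpen U)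
    (hXU : X ⊆ U) (hcl : closure X ∩ U ⊆ X) (hX : X.Nonempty)
    (hT : ∀ a, ContDiff ℝ ∞ (T a)) (hT0 : ∀ a x, iteratedFDeriv ℝ (m + 1) (T a) x = 0)
    (hW : ∀ K ⊆ X, IsCompact K → ∀ ε > 0, ∃ δ > 0, WhitneyEstimate m T K ε δ) :
    ∃ f : E → ℝ, ContDiffOn ℝ m f U ∧
      ∀ k ≤ m, ∀ x ∈ X, iteratedFDerivWithin ℝ k f U x = iteratedFDeriv ℝ k (T x) x := by
  classical
  obtain ⟨f, C, hC, hfX, hfs, hf⟩ := exists_extension_near_polynomials (m := m) hX hT hT0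
  have hΩ : IsOpen {x | 0 < infDist x X} :=
    isOpen_setOf_pos fun x y => infDist_le_infDist_add_dist
  have hmemΩ : ∀ x ∈ U, x ∉ X → 0 < infDist x X := fun x hxU hxX =>
    (infDist_pos_iff_notMem_closure hX).1 fun h => hxX (hcl ⟨h, hxU⟩)
  let P : E → FormalMultilinearSeries ℝ E ℝ := fun x k =>
    if x ∈ X then iteratedFDeriv ℝ k (T x) x else iteratedFDeriv ℝ k f x
  have hPX : ∀ x ∈ X, ∀ k, P x k = iteratedFDeriv ℝ k (T x) x := fun x hx k => by simp [P, hx]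
  have hPΩ : ∀ x, 0 < infDist x X → ∀ k, P x k = iteratedFDeriv ℝ k f x := fun x hx k => by
    have : x ∉ X := fun h => hx.ne' (infDist_zero_of_mem h)
    simp [P, this]
  have key : ∀ a ∈ X, ∀ k ≤ m, ∀ ε > 0, ∀ᶠ y in 𝓝[U] a,
      ‖P y k - iteratedFDeriv ℝ k (T a) y‖ ≤ ε * dist y a ^ (m - k) := by
    intro a ha k hk ε hε
    obtain ⟨r, hr, hrU⟩ := Metric.nhds_basis_closedBall.mem_iff.1 (hU.mem_nhds (hXU ha))
    have hK : IsCompact (closedBall a r ∩ X) := by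
      have : closedBall a r ∩ X = closedBall a r ∩ closure X :=
        Subset.antisymm (inter_subset_inter_right _ subset_closure)
          fun y hy => ⟨hy.1, hcl ⟨hy.2, hrU hy.1⟩⟩
      rw [this]
      exact (isCompact_closedBall a r).inter_right isClosed_closure
    set M : ℝ := C + (m + 1) * 3 ^ m + 1
    have hM : 1 ≤ M := by
      have : 0 ≤ C + (m + 1) * 3 ^ m := by positivity
      linarith
    set ε' := ε / M
    have hε' : 0 < ε' := by positivity
    obtain ⟨δ, hδ, hWK⟩ := hW _ inter_subset_right hK ε' hε'
    have haK : a ∈ closedBall a r ∩ X := ⟨mem_closedBall_self hr.le, ha⟩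
    filter_upwards [self_mem_nhdsWithin, mem_nhdsWithin_of_mem_nhds
      (ball_mem_nhds a (by positivity : 0 < min (r / 4) (δ / 5)))] with y hyU hy
    obtain ⟨hyr, hyδ⟩ := lt_min_iff.1 (mem_ball.1 hy)
    have hε'ε : ε' ≤ ε := div_le_self hε.le hM
    by_cases hyX : y ∈ X
    · rw [hPX y hyX]
      have := hWK a haK y ⟨mem_closedBall.2 (by linarith), hyX⟩
        (by rw [dist_comm]; linarith) k hk
      rw [dist_comm a y] at this
      exact this.trans (by gcongr)
    · have hy0 := hmemΩ y hyU hyX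
      have hda : infDist y X ≤ dist y a := infDist_le_dist_of_mem ha
      have hsub : closedBall y (3 * infDist y X) ∩ X ⊆ closedBall a r ∩ X := by
        refine fun z hz => ⟨?_, hz.2⟩
        have h1 := mem_closedBall.1 hz.1
        have h2 := dist_triangle z y a
        exact mem_closedBall.2 (by linarith)
      obtain ⟨b, hbX, hyb, hb⟩ := hf _ ε' δ hε'.le hWK y hy0 hsub (by linarith)
      have hab := dist_triangle a y b
      rw [dist_comm a y] at hab
      have hbK : b ∈ closedBall a r ∩ X :=
        ⟨mem_closedBall.2 (by rw [dist_comm]; linarith), hbX⟩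
      have h1 := hWK.norm_iteratedFDeriv_sub_le hT hT0 hε'.le haK hbK (by linarith)
        (ρ := 3 * dist y a) (by linarith) (x := y) (by linarith [hda.trans' hy0.le]) hk
      have hle : ((k : ℕ∞) : ℕ∞ω) ≤ ∞ := by exact_mod_cast le_top
      rw [iteratedFDeriv_sub_apply ((hT b).contDiffAt.of_le hle)
        ((hT a).contDiffAt.of_le hle)] at h1
      rw [hPΩ y hy0]
      refine (norm_sub_le_norm_sub_add_norm_sub _ (iteratedFDeriv ℝ k (T b) y) _).trans ?_
      have h2 : C * ε' * infDist y X ^ (m - k) ≤ C * ε' * dist y a ^ (m - k) := by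
        gcongr
      have h3 : (m + 1) * ε' * (3 * dist y a) ^ (m - k) ≤
          (m + 1) * 3 ^ m * ε' * dist y a ^ (m - k) := by
        rw [mul_pow]
        calc (m + 1) * ε' * (3 ^ (m - k) * dist y a ^ (m - k))
            ≤ (m + 1) * ε' * (3 ^ m * dist y a ^ (m - k)) := by
              gcongr
              · norm_num
              · exact Nat.sub_le _ _
          _ = _ := by ring
      have h4 : ε = M * ε' := by
        simp only [ε']
        field_simp
      have h5 : 0 ≤ ε' * dist y a ^ (m - k) := by positivity
      calc _ ≤ C * ε' * dist y a ^ (m - k) + (m + 1) * 3 ^ m * ε' * dist y a ^ (m - k) :=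
            add_le_add ((hb k hk).trans h2) (h1.trans h3)
        _ ≤ M * ε' * dist y a ^ (m - k) := by
            simp only [M]
            linarith
        _ = _ := by rw [← h4]
  have hTa : ∀ a k x, HasFDerivAt (iteratedFDeriv ℝ k (T a))
      (iteratedFDeriv ℝ (k + 1) (T a) x).curryLeft x := fun a k x =>
    (hT a).contDiffAt.hasFDerivAt_iteratedFDeriv k
  have hPnhds : ∀ x, 0 < infDist x X → ∀ k, (P · k) =ᶠ[𝓝 x] iteratedFDeriv ℝ k f := by
    intro x hx k
    filter_upwards [hΩ.mem_nhds hx] with y hy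
    exact hPΩ y hy k
  have hPd : ∀ x, 0 < infDist x X → ∀ k, HasFDerivAt (P · k) (P x (k + 1)).curryLeft x := by
    intro x hx k
    rw [hPΩ x hx]
    exact ((hfs.contDiffAt (hΩ.mem_nhds hx)).hasFDerivAt_iteratedFDeriv k).congr_of_eventuallyEq
      (hPnhds x hx k)
  have hP : HasFTaylorSeriesUpToOn m f P U := by
    refine ⟨fun x hx => ?_, fun k hk x hx => ?_, fun k hk x hx => ?_⟩
    · by_cases hxX : x ∈ X
      · rw [hPX x hxX, hfX x hxX]
        rfl
      · rw [hPΩ x (hmemΩ x hx hxX)]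
        rfl
    · replace hk : k < m := by exact_mod_cast hk
      by_cases hxX : x ∈ X
      · have h0 : HasFDerivWithinAt (fun y => P y k - iteratedFDeriv ℝ k (T x) y)
            (0 : E →L[ℝ] E [×k]→L[ℝ] ℝ) U x := by
          refine HasFDerivWithinAt.of_isLittleO (Asymptotics.isLittleO_iff.2 fun c hc => ?_)
          filter_upwards [key x hxX k hk.le c hc,
            mem_nhdsWithin_of_mem_nhds (closedBall_mem_nhds x one_pos)] with y hy hy1
          rw [hPX x hxX, sub_self, sub_zero, zero_apply, sub_zero,
            ← dist_eq_norm y x]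
          refine hy.trans ?_
          gcongr
          exact pow_le_of_le_one dist_nonneg hy1 (by omega)
        have h1 := h0.add (hTa x k x).hasFDerivWithinAt
        rw [zero_add] at h1
        rw [hPX x hxX]
        exact h1.congr_of_eventuallyEq (Eventually.of_forall fun y => by simp) (by simp)
      · exact (hPd x (hmemΩ x hx hxX) k).hasFDerivWithinAt
    · replace hk : k ≤ m := by exact_mod_cast hk
      by_cases hxX : x ∈ X
      · have h0 : Tendsto (fun y => P y k - iteratedFDeriv ℝ k (T x) y) (𝓝[U] x) (𝓝 0) := by
          rw [Metric.tendsto_nhds]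
          intro c hc
          filter_upwards [key x hxX k hk (c / 2) (half_pos hc),
            mem_nhdsWithin_of_mem_nhds (closedBall_mem_nhds x one_pos)] with y hy hy1
          rw [dist_zero_right]
          refine hy.trans_lt (lt_of_le_of_lt ?_ (half_lt_self hc))
          exact mul_le_of_le_one_right (half_pos hc).le (pow_le_one₀ dist_nonneg hy1)
        have h1 := h0.add ((hTa x k x).continuousAt.continuousWithinAt (s := U)).tendsto
        rw [zero_add] at h1
        simp only [sub_add_cancel] at h1
        rw [← hPX x hxX] at h1
        exact h1
      · exact (hPd x (hmemΩ x hx hxX) k).continuousAt.continuousWithinAt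
  refine ⟨f, HasFTaylorSeriesUpToOn.contDiffOn (n := (m : ℕ∞)) hP, fun k hk x hx => ?_⟩
  rw [← hP.eq_iteratedFDerivWithin_of_uniqueDiffOn (by exact_mod_cast hk) hU.uniqueDiffOn (hXU hx),
    hPX x hx]

end Extension

lemma IsWhitney.exists_whitneyEstimate {n m : ℕ} {X : Set (EuclideanSpace ℝ (Fin n))}
    {F : (Fin n → ℕ) → EuclideanSpace ℝ (Fin n) → ℝ} (hF : IsWhitney m X F)
    {K : Set (EuclideanSpace ℝ (Fin n))} (hKX : K ⊆ X) (hK : IsCompact K) {ε : ℝ} (hε : 0 < ε) :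
    ∃ δ > 0, WhitneyEstimate m (taylorPoly m F 0) K ε δ := by
  have hj : ∀ (k : Fin (m + 1)) (j : Fin k → Fin n), ∀ᶠ δ in 𝓝[>] (0 : ℝ),
      ∀ a ∈ K, ∀ b ∈ K, 0 < dist a b → dist a b ≤ δ →
        |taylorRem m F (occurrences j) a b| ≤
          ε / (Fintype.card (Fin k → Fin n) + 1) * dist a b ^ (m - k) := by
    intro k j
    obtain ⟨δ, hδ, h⟩ := hF.2 K hK hKX (occurrences j)
      (by rw [sum_occurrences]; exact Nat.lt_succ_iff.1 k.2)
      (ε / (Fintype.card (Fin k → Fin n) + 1)) (by positivity)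
    rw [sum_occurrences] at h
    filter_upwards [Ioc_mem_nhdsGT hδ] with δ' hδ' a ha b hb hab habδ
    exact h a ha b hb hab (habδ.trans hδ'.2)
  have hall := eventually_all.2 fun k => eventually_all.2 fun j => hj k j
  obtain ⟨δ, h, hδ⟩ := (hall.and self_mem_nhdsWithin).exists
  refine ⟨δ, hδ, fun a ha b hb hab k hk => ?_⟩
  rcases eq_or_ne a b with rfl | hne
  · rw [sub_self, norm_zero]
    positivity
  refine (ContinuousMultilinearMap.norm_le_sum_single _).trans ?_
  refine (Finset.sum_le_card_nsmul _ _
    (ε / (Fintype.card (Fin k → Fin n) + 1) * dist a b ^ (m - k)) fun j _ => ?_).trans ?_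
  · rw [sub_apply, iteratedFDeriv_taylorPoly _ _ _ hk,
      iteratedFDeriv_taylorPoly _ _ _ hk, taylorPoly_self, ← taylorRem_eq_sub_taylorPoly]
    exact h ⟨k, Nat.lt_succ_iff.2 hk⟩ j a ha b hb (dist_pos.2 hne) hab
  · rw [nsmul_eq_mul, Finset.card_univ, ← mul_assoc]
    gcongr
    rw [mul_div_assoc', div_le_iff₀ (by positivity)]
    linarith

/-- Whitney Extension Theorem, finite order: every Whitney function `F` of class `m` on a
nonempty relatively closed subset `X` of an open set `U ⊆ ℝⁿ` extends to `f ∈ C^m(U)` whose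
partial derivatives of order `≤ m` on `X` coincide with the components of `F`. Here the partial
derivative `∂^β f (x)` for `|β| = k ≤ m` is expressed as the `k`-th iterated derivative of `f`
applied to coordinate basis vectors listed by `j : Fin k → Fin n`, with `β i` the number of
occurrences of `i` in `j`. -/
theorem whitney_extension_finite {n : ℕ} (U X : Set (EuclideanSpace ℝ (Fin n)))
    (hU : IsOpen U) (hXU : X ⊆ U) (hrc : closure X ∩ U = X) (hne : X.Nonempty) (m : ℕ)
    (F : (Fin n → ℕ) → EuclideanSpace ℝ (Fin n) → ℝ) (hF : IsWhitney m X F) :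
    ∃ f : EuclideanSpace ℝ (Fin n) → ℝ, ContDiffOn ℝ m f U ∧
      ∀ k : ℕ, k ≤ m → ∀ j : Fin k → Fin n, ∀ x ∈ X,
        iteratedFDerivWithin ℝ k f U x (fun l => EuclideanSpace.single (j l) 1)
          = F (fun i => (Finset.univ.filter (fun l => j l = i)).card) x := by
  obtain ⟨f, hf, hfX⟩ := exists_contDiffOn_extension hU hXU hrc.subset hne
    (fun a => contDiff_taylorPoly m F 0 a) (iteratedFDeriv_taylorPoly_eq_zero m F)
    fun K hKX hK ε hε => hF.exists_whitneyEstimate hKX hK hε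
  refine ⟨f, hf, fun k hk j x hx => ?_⟩
  rw [hfX k hk x hx, iteratedFDeriv_taylorPoly m F x hk, taylorPoly_self]
  rfl
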